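/- For every complex q with |q| < 1, the generating function of the number of non-Rascoe partitions satisfies ∑_{N=1}^{∞} b(N) q^N = ∑_{n=1}^{∞} q^{n(n+1)/2} ∑_{m=1}^{n} [n-1 choose m-1]_q · q^{m²} / (q;q)_m. -/

import Mathlib

open scoped BigOperators

/-- The finite q-Pochhammer symbol `(a;q)_n`. -/
noncomputable def qPoch (a q : ℂ) (n : ℕ) : ℂ := ∏ k ∈ Finset.range n, (1 - a * q ^ k)

/-- The Gaussian binomial coefficient `[N choose n]_q`. -/
noncomputable def qbinom (q : ℂ) (N n : ℕ) : ℂ :=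
  if n ≤ N then qPoch q q N / (qPoch q q n * qPoch q q (N - n)) else 0

/-- `b n` is the number of non-Rascoe partitions of `n`: partitions into distinct parts in
which the number of parts is not itself a part.  (For `n = 0` the empty partition counts,
so `b 0 = 1`.) -/
noncomputable def b (n : ℕ) : ℕ :=
  Nat.card {p : Nat.Partition n // p.parts.Nodup ∧ Multiset.card p.parts ∉ p.parts}

open Finset Filter Topology

lemma qPoch_succ (a q : ℂ) (n : ℕ) : qPoch a q (n + 1) = qPoch a q n * (1 - a * q ^ n) :=
  prod_range_succ _ _

lemma qPoch_self_ne_zero {q : ℂ} (hq : ‖q‖ < 1) (n : ℕ) : qPoch q q n ≠ 0 := by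
  refine prod_ne_zero_iff.2 fun k _ h => ?_
  have h1 : ‖q ^ (k + 1)‖ < 1 := by
    rw [norm_pow]
    exact pow_lt_one₀ (norm_nonneg q) hq k.succ_ne_zero
  rw [pow_succ', ← sub_eq_zero.1 h] at h1
  simp at h1

lemma qbinom_zero_right {q : ℂ} (hq : ‖q‖ < 1) (N : ℕ) : qbinom q N 0 = 1 := by
  have := qPoch_self_ne_zero hq N
  simp [qbinom, this, show qPoch q q 0 = 1 from prod_range_zero _]

lemma qbinom_symm (q : ℂ) {N n : ℕ} (h : n ≤ N) : qbinom q N (N - n) = qbinom q N n := by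
  simp [qbinom, h, Nat.sub_sub_self h, mul_comm]

/-- The `q`-Pascal rule. -/
lemma qbinom_succ_succ {q : ℂ} (hq : ‖q‖ < 1) {N j : ℕ} (h : j ≤ N) :
    qbinom q (N + 1) (j + 1) = qbinom q N (j + 1) + q ^ (N - j) * qbinom q N j := by
  obtain ⟨d, rfl⟩ := Nat.exists_eq_add_of_le h
  have hP := qPoch_self_ne_zero hq
  have hj := hP (j + 1)
  rw [qPoch_succ] at hj
  obtain ⟨hj0, hj1⟩ := mul_ne_zero_iff.1 hj
  have h0 : qPoch q q 0 = 1 := prod_range_zero _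
  rcases d with _ | d
  · have h2 := hP (j + 1)
    simp [qbinom, h0, hj0, h2]
  · have hd := hP (d + 1)
    rw [qPoch_succ] at hd
    obtain ⟨hd0, hd1⟩ := mul_ne_zero_iff.1 hd
    have e1 : j + (d + 1) + 1 - (j + 1) = d + 1 := by omega
    have e2 : j + (d + 1) - (j + 1) = d := by omega
    have e3 : j + (d + 1) - j = d + 1 := by omega
    rw [qbinom, qbinom, qbinom, if_pos (by omega), if_pos (by omega), if_pos h, e1, e2, e3,
      qPoch_succ q q (j + (d + 1)), qPoch_succ q q j, qPoch_succ q q d]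
    field_simp
    ring

/-- The `q`-binomial theorem, as an identity between sums over subsets. -/
lemma sum_powersetCard_pow_sum {q : ℂ} (hq : ‖q‖ < 1) (N j : ℕ) :
    ∑ S ∈ powersetCard j (range N), q ^ (∑ i ∈ S, i) = q ^ j.choose 2 * qbinom q N j := by
  induction N generalizing j with
  | zero =>
    rcases j with _ | j
    · simp [qbinom_zero_right hq]
    · rw [range_zero, powersetCard_eq_empty.2 (by simp)]
      simp [qbinom]
  | succ N ih =>
    rcases j with _ | j
    · simp [qbinom_zero_right hq]
    rw [range_add_one, powersetCard_succ_insert notMem_range_self, sum_union, sum_image, ih]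
    · have : ∑ S ∈ powersetCard j (range N), q ^ (∑ i ∈ insert N S, i) =
          q ^ N * ∑ S ∈ powersetCard j (range N), q ^ (∑ i ∈ S, i) := by
        rw [mul_sum]
        refine sum_congr rfl fun S hS => ?_
        rw [sum_insert, pow_add]
        exact fun h => notMem_range_self ((mem_powersetCard.1 hS).1 h)
      rw [this, ih]
      rcases le_or_gt j N with h | h
      · rw [qbinom_succ_succ hq h, Nat.choose_succ_succ' j 1, Nat.choose_one_right, pow_add]
        nth_rewrite 2 [← Nat.sub_add_cancel h]
        rw [pow_add]
        ring
      · simp [qbinom, h.not_ge, show ¬ j + 1 ≤ N by omega]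
    · intro S hS T hT h
      have hn : ∀ {V}, V ∈ powersetCard j (range N) → N ∉ V :=
        fun hV h => notMem_range_self ((mem_powersetCard.1 hV).1 h)
      rw [← erase_insert (hn hS), ← erase_insert (hn hT)]
      exact congrArg (fun V => V.erase N) h
    · refine disjoint_left.2 fun S hS hS' => ?_
      obtain ⟨T, -, rfl⟩ := mem_image.1 hS'
      exact notMem_range_self ((mem_powersetCard.1 hS).1 (mem_insert_self N T))

lemma tendsto_qbinom {q : ℂ} (hq : ‖q‖ < 1) (m : ℕ) :
    Tendsto (fun N => qbinom q N m) atTop (𝓝 (1 / qPoch q q m)) := by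
  induction m with
  | zero => simp [qbinom_zero_right hq, show qPoch q q 0 = 1 from prod_range_zero _]
  | succ m ih =>
    have hpow : Tendsto (fun N => 1 - q * q ^ (N - (m + 1))) atTop (𝓝 1) := by
      simpa using (((tendsto_pow_atTop_nhds_zero_of_norm_lt_one hq).comp
        (tendsto_sub_atTop_nat (m + 1))).const_mul q).const_sub 1
    have hm := qPoch_self_ne_zero hq (m + 1)
    rw [qPoch_succ] at hm
    obtain ⟨hm0, hm1⟩ := mul_ne_zero_iff.1 hm
    have := (ih.mul hpow).div_const (1 - q * q ^ m)
    rw [mul_one, div_div, ← qPoch_succ] at this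
    refine this.congr' ?_
    filter_upwards [eventually_ge_atTop (m + 1)] with N hN
    obtain ⟨d, rfl⟩ := Nat.exists_eq_add_of_le hN
    have hd := qPoch_self_ne_zero hq (d + 1)
    rw [qPoch_succ] at hd
    obtain ⟨hd0, hd1⟩ := mul_ne_zero_iff.1 hd
    rw [qbinom, qbinom, if_pos hN, if_pos (by omega), Nat.add_sub_cancel_left,
      show m + 1 + d - m = d + 1 by omega, qPoch_succ q q m, qPoch_succ q q d]
    field_simp

lemma summable_pow_sum {q : ℂ} (hq : ‖q‖ < 1) :
    Summable fun S : Finset ℕ => q ^ (∑ i ∈ S, i) := by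
  simp_rw [← prod_pow_eq_pow_sum]
  exact summable_finsetProd_of_summable_norm
    (by simpa using summable_geometric_of_lt_one (norm_nonneg q) hq)

/-- Partitions into `m` distinct nonnegative parts. -/
lemma tsum_card_eq_pow_sum {q : ℂ} (hq : ‖q‖ < 1) (m : ℕ) :
    ∑' U : {U : Finset ℕ // #U = m}, q ^ (∑ i ∈ U.1, i) = q ^ m.choose 2 / qPoch q q m := by
  have hsum : Summable fun U : {U : Finset ℕ // #U = m} => q ^ (∑ i ∈ U.1, i) :=
    (summable_pow_sum hq).subtype {U | #U = m}
  have hlim : Tendsto (fun N => (powersetCard m (range N)).subtype (#· = m)) atTop atTop := by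
    refine tendsto_atTop_finset_of_monotone
      (fun a b h => subtype_mono (powersetCard_mono (range_mono h))) fun U => ?_
    obtain ⟨N, hN⟩ := exists_nat_subset_range U.1
    exact ⟨N, by simp [hN, U.2]⟩
  have h1 := hsum.hasSum.comp hlim
  have h2 := (tendsto_qbinom hq m).const_mul (q ^ m.choose 2)
  rw [mul_one_div] at h2
  refine tendsto_nhds_unique (h1.congr fun N => ?_) h2
  rw [← sum_powersetCard_pow_sum hq, Function.comp_apply,
    sum_subtype_of_mem (fun S => q ^ (∑ i ∈ S, i)) fun S hS => (mem_powersetCard.1 hS).2]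

/-- The nonempty finite sets of positive integers that do not contain their own cardinality. -/
def NonRascoe : Set (Finset ℕ) := {S | S.Nonempty ∧ 0 ∉ S ∧ #S ∉ S}

lemma one_le_sum_of_mem_nonRascoe {S : Finset ℕ} (hS : S ∈ NonRascoe) : 1 ≤ ∑ i ∈ S, i := by
  obtain ⟨⟨x, hx⟩, h0, -⟩ := hS
  have : x ≠ 0 := fun h => h0 (h ▸ hx)
  have : x ≤ ∑ i ∈ S, i := single_le_sum (f := fun i => i) (fun i _ => Nat.zero_le i) hx
  omega

/-- The set with parts `a + 1` for `a ∈ A` and `u + n + 2` for `u ∈ U`. -/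
def joinParts (n : ℕ) (A U : Finset ℕ) : Finset ℕ :=
  A.map (addRightEmbedding 1) ∪ U.map (addRightEmbedding (n + 2))

section joinParts

variable {n : ℕ} {A U : Finset ℕ}

lemma mem_joinParts {x : ℕ} :
    x ∈ joinParts n A U ↔ (∃ a ∈ A, a + 1 = x) ∨ ∃ u ∈ U, u + (n + 2) = x := by
  simp [joinParts]

lemma disjoint_joinParts (hA : A ⊆ range n) :
    Disjoint (A.map (addRightEmbedding 1)) (U.map (addRightEmbedding (n + 2))) := by
  simp only [disjoint_left, Finset.mem_map, addRightEmbedding_apply, not_exists, not_and]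
  rintro _ ⟨a, ha, rfl⟩ u -
  have := mem_range.1 (hA ha)
  omega

lemma card_joinParts (hA : A ⊆ range n) : #(joinParts n A U) = #A + #U := by
  rw [joinParts, card_union_of_disjoint (disjoint_joinParts hA), card_map, card_map]

lemma sum_joinParts (hA : A ⊆ range n) :
    ∑ i ∈ joinParts n A U, i = (∑ i ∈ A, i + #A) + (∑ i ∈ U, i + #U * (n + 2)) := by
  simp [joinParts, sum_union (disjoint_joinParts hA), sum_add_distrib]

lemma succ_mem_joinParts {a : ℕ} (ha : a < n) : a + 1 ∈ joinParts n A U ↔ a ∈ A := by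
  rw [mem_joinParts]
  constructor
  · rintro (⟨a', h, h'⟩ | ⟨u, -, h⟩)
    · rwa [← Nat.succ_injective h']
    · omega
  · exact fun h => .inl ⟨a, h, rfl⟩

lemma add_mem_joinParts (hA : A ⊆ range n) {u : ℕ} : u + (n + 2) ∈ joinParts n A U ↔ u ∈ U := by
  rw [mem_joinParts]
  constructor
  · rintro (⟨a, h, h'⟩ | ⟨u', h, h'⟩)
    · have := mem_range.1 (hA h)
      omega
    · rwa [← Nat.add_right_cancel h']
  · exact fun h => .inr ⟨u, h, rfl⟩

lemma joinParts_mem_nonRascoe (hA : A ⊆ range n) (h : #A + #U = n + 1) :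
    joinParts n A U ∈ NonRascoe := by
  have hc := (card_joinParts (U := U) hA).trans h
  refine ⟨card_pos.1 (by omega), fun h0 => ?_, fun h1 => ?_⟩
  · rcases mem_joinParts.1 h0 with ⟨a, -, h'⟩ | ⟨u, -, h'⟩ <;> omega
  · rw [hc] at h1
    rcases mem_joinParts.1 h1 with ⟨a, ha, h'⟩ | ⟨u, -, h'⟩
    · have := mem_range.1 (hA ha)
      omega
    · omega

lemma exists_eq_joinParts {S : Finset ℕ} (h0 : 0 ∉ S) (hn : n + 1 ∉ S) :
    ∃ A U, A ⊆ range n ∧ joinParts n A U = S := by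
  refine ⟨{a ∈ range n | a + 1 ∈ S}, {x ∈ S | n + 2 ≤ x}.image (· - (n + 2)),
    filter_subset _ _, ?_⟩
  ext x
  simp only [mem_joinParts, mem_filter, mem_range, mem_image]
  constructor
  · rintro (⟨a, ⟨-, h⟩, rfl⟩ | ⟨_, ⟨y, ⟨hy, hle⟩, rfl⟩, rfl⟩)
    · exact h
    · rwa [Nat.sub_add_cancel hle]
  · intro hx
    have hx0 : x ≠ 0 := fun h => h0 (h ▸ hx)
    have hxn : x ≠ n + 1 := fun h => hn (h ▸ hx)
    rcases lt_or_ge x (n + 1) with h | h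
    · have e : x - 1 + 1 = x := by omega
      exact .inl ⟨x - 1, ⟨by omega, e.symm ▸ hx⟩, e⟩
    · exact .inr ⟨x - (n + 2), ⟨x, ⟨hx, by omega⟩, rfl⟩, by omega⟩

end joinParts

lemma card_eq_of_fiber {n : ℕ} (S : (fun S : NonRascoe => #S.1 - 1) ⁻¹' {n}) :
    #S.1.1 = n + 1 := by
  have h1 : #S.1.1 - 1 = n := S.2
  have h2 := card_pos.2 S.1.2.1
  omega

/-- The parts below and above `n + 1` determine a set in `NonRascoe` of cardinality `n + 1`. -/
noncomputable def joinEquiv (n : ℕ) :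
    (Σ A : (range n).powerset, {U : Finset ℕ // #U = n + 1 - #A.1}) ≃
      (fun S : NonRascoe => #S.1 - 1) ⁻¹' {n} :=
  have hc (A : (range n).powerset) (U : {U : Finset ℕ // #U = n + 1 - #A.1}) :
      #A.1 + #U.1 = n + 1 := by
    have := card_le_card (mem_powerset.1 A.2)
    rw [card_range] at this
    have := U.2
    omega
  Equiv.ofBijective
    (fun p => ⟨⟨joinParts n p.1 p.2, joinParts_mem_nonRascoe (mem_powerset.1 p.1.2) (hc p.1 p.2)⟩,
      by simp [card_joinParts (mem_powerset.1 p.1.2), hc p.1 p.2]⟩) <| by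
    constructor
    · rintro ⟨⟨A, hA⟩, U, hU⟩ ⟨⟨A', hA'⟩, U', hU'⟩ h
      have hS : joinParts n A U = joinParts n A' U' := congrArg (fun S => S.1.1) h
      have h1 := mem_powerset.1 hA
      have h2 := mem_powerset.1 hA'
      obtain rfl : A = A' := by
        ext a
        by_cases ha : a < n
        · rw [← succ_mem_joinParts ha, hS, succ_mem_joinParts ha]
        · exact iff_of_false (fun h => ha (mem_range.1 (h1 h))) fun h => ha (mem_range.1 (h2 h))
      obtain rfl : U = U' := by
        ext u
        rw [← add_mem_joinParts h1, hS, add_mem_joinParts h1]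
      rfl
    · intro S
      have hS := card_eq_of_fiber S
      obtain ⟨A, U, hA, h⟩ := exists_eq_joinParts (n := n) S.1.2.2.1 (hS ▸ S.1.2.2.2)
      refine ⟨⟨⟨A, mem_powerset.2 hA⟩, U, ?_⟩, Subtype.ext (Subtype.ext h)⟩
      have := card_joinParts (U := U) hA
      rw [h, hS] at this
      simp only
      omega

lemma joinEquiv_apply_coe {n : ℕ}
    (p : Σ A : (range n).powerset, {U : Finset ℕ // #U = n + 1 - #A.1}) :
    (joinEquiv n p).1.1 = joinParts n p.1 p.2 := rfl

lemma choose_two_add_choose_two (k m : ℕ) :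
    k + (m + 1) * (k + m + 2) + (m + 1).choose 2 + k.choose 2 =
      (k + m + 1) * (k + m + 2) / 2 + (m + 1) ^ 2 := by
  have h : (k + m + 1) * (k + m + 2) / 2 = (k + m + 2).choose 2 := by
    rw [Nat.choose_two_right, mul_comm]
    rfl
  rw [h, ← Nat.cast_inj (R := ℚ)]
  push_cast [Nat.cast_choose_two]
  ring

/-- Summing over the elements of `NonRascoe` of cardinality `n + 1`. -/
lemma tsum_fiber_card {q : ℂ} (hq : ‖q‖ < 1) (n : ℕ) :
    ∑' S : (fun S : NonRascoe => #S.1 - 1) ⁻¹' {n}, q ^ (∑ i ∈ S.1.1, i) =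
      q ^ ((n + 1) * (n + 2) / 2) *
        ∑ m ∈ range (n + 1), qbinom q n m * q ^ ((m + 1) ^ 2) / qPoch q q (m + 1) := by
  have hsum : Summable fun S : (fun S : NonRascoe => #S.1 - 1) ⁻¹' {n} =>
      q ^ (∑ i ∈ S.1.1, i) :=
    ((summable_pow_sum hq).subtype NonRascoe).subtype _
  have hsum' : Summable fun p => q ^ (∑ i ∈ (joinEquiv n p).1.1, i) :=
    hsum.comp_injective (joinEquiv n).injective
  have hfib (A : (range n).powerset) :
      ∑' U : {U : Finset ℕ // #U = n + 1 - #A.1},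
        q ^ (∑ i ∈ ((joinEquiv n) ⟨A, U⟩).1.1, i) =
      q ^ (∑ i ∈ A.1, i) * (q ^ (#A.1 + (n + 1 - #A.1) * (n + 2)) *
        (q ^ (n + 1 - #A.1).choose 2 / qPoch q q (n + 1 - #A.1))) := by
    rw [← tsum_card_eq_pow_sum hq, ← mul_assoc, ← tsum_mul_left]
    refine tsum_congr fun U => ?_
    rw [joinEquiv_apply_coe, sum_joinParts (mem_powerset.1 A.2), U.2, ← pow_add, ← pow_add]
    congr 1
    ring
  rw [← (joinEquiv n).tsum_eq, hsum'.tsum_sigma,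
    tsum_congr hfib, tsum_fintype,
    sum_coe_sort (range n).powerset fun A => q ^ (∑ i ∈ A, i) *
      (q ^ (#A + (n + 1 - #A) * (n + 2)) * (q ^ (n + 1 - #A).choose 2 / qPoch q q (n + 1 - #A))),
    sum_powerset, card_range, ← sum_range_reflect, mul_sum]
  refine sum_congr rfl fun m hm => ?_
  obtain ⟨k, rfl⟩ := Nat.exists_eq_add_of_le' (Nat.lt_succ_iff.1 (mem_range.1 hm))
  have e1 : k + m + 1 - 1 - m = k := by omega
  have e2 : k + m + 1 - k = m + 1 := by omega
  rw [e1, sum_congr rfl fun A hA => by rw [(mem_powersetCard.1 hA).2, e2], ← sum_mul,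
    sum_powersetCard_pow_sum hq, ← qbinom_symm q (Nat.le_add_left m k), Nat.add_sub_cancel,
    mul_div_assoc', mul_div_assoc', mul_div_assoc']
  congr 1
  have := congrArg (q ^ ·) (choose_two_add_choose_two k m)
  simp only [pow_add _ (_ / _), pow_add _ (_ + _) (Nat.choose _ _)] at this
  linear_combination qbinom q (k + m) k * this

lemma sum_eq_of_fiber {N : ℕ} (S : (fun S : NonRascoe => ∑ i ∈ S.1, i - 1) ⁻¹' {N}) :
    ∑ i ∈ S.1.1, i = N + 1 := by
  have h1 : ∑ i ∈ S.1.1, i - 1 = N := S.2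
  have h2 := one_le_sum_of_mem_nonRascoe S.1.2
  omega

lemma card_fiber_sum (N : ℕ) :
    Nat.card ((fun S : NonRascoe => ∑ i ∈ S.1, i - 1) ⁻¹' {N}) = b (N + 1) := by
  refine Nat.card_congr
    { toFun S := ⟨⟨S.1.1.val, fun {i} hi => Nat.pos_of_ne_zero fun h => S.1.2.2.1 (h ▸ hi), ?_⟩,
        S.1.1.nodup, S.1.2.2.2⟩
      invFun p := ⟨⟨⟨p.1.parts, p.2.1⟩, ?_, fun h => (p.1.parts_pos h).false, p.2.2⟩, ?_⟩
      left_inv S := rfl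
      right_inv p := rfl }
  · rw [← sum_eq_of_fiber S, sum_eq_multiset_sum, Multiset.map_id']
  · refine nonempty_iff_ne_empty.2 fun h => ?_
    have h1 := p.1.parts_sum
    rw [show p.1.parts = 0 from congrArg val h] at h1
    simp at h1
  · have : ∑ i ∈ (⟨p.1.parts, p.2.1⟩ : Finset ℕ), i = N + 1 := by
      rw [sum_eq_multiset_sum, Multiset.map_id', p.1.parts_sum]
    simp [this]

theorem nonRascoe_double_sum_gen_fun (q : ℂ) (hq : ‖q‖ < 1) :
    ∑' N : ℕ, (b (N + 1) : ℂ) * q ^ (N + 1)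
      = ∑' n : ℕ, q ^ ((n + 1) * (n + 2) / 2) *
          ∑ m ∈ Finset.range (n + 1),
            qbinom q n m * q ^ ((m + 1) ^ 2) / qPoch q q (m + 1) := by
  have hsum : HasSum (fun S : NonRascoe => q ^ (∑ i ∈ S.1, i)) _ :=
    ((summable_pow_sum hq).subtype NonRascoe).hasSum
  have h1 := (hsum.tsum_fiberwise fun S : NonRascoe => ∑ i ∈ S.1, i - 1).tsum_eq
  have h2 := (hsum.tsum_fiberwise fun S : NonRascoe => #S.1 - 1).tsum_eq
  rw [← tsum_congr (tsum_fiber_card hq), h2, ← h1]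
  refine tsum_congr fun N => ?_
  rw [tsum_congr fun S => congrArg (q ^ ·) (sum_eq_of_fiber S), tsum_const, card_fiber_sum,
    nsmul_eq_mul]
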